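/- arXiv:2302.02262 — 2 statements merged into one kernel-verified Lean document; each statement's English description precedes it below -/
import Mathlib

section
/- Let p≥1, 0<R<∞, α real with α - p + 1 > 0. Then for every u locally absolutely continuous on (0,R) with lim_{r→R} u(r) = 0, one has (∫₀ᴿ|u|^p r^{α-p}dr)^{1/p} ≤ (p/(α-p+1)) (∫₀ᴿ|u'|^p r^{α}dr)^{1/p}. -/
open Real MeasureTheory Set

/-- The lower integral of a power over `(0, s)`. -/
theorem lintegral_Ioo_zero_rpow {e s : ℝ} (he : -1 < e) (hs : 0 ≤ s) :
    ∫⁻ r in Ioo (0:ℝ) s, ENNReal.ofReal (r ^ e) = ENNReal.ofReal (s ^ (e + 1) / (e + 1)) := by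
  have hi : IntegrableOn (fun r : ℝ => r ^ e) (Ioc 0 s) :=
    (intervalIntegrable_iff_integrableOn_Ioc_of_le hs).1
      (intervalIntegral.intervalIntegrable_rpow' he)
  have hnn : 0 ≤ᵐ[volume.restrict (Ioc 0 s)] fun r : ℝ => r ^ e := by
    filter_upwards [ae_restrict_mem measurableSet_Ioc] with r hr
    exact rpow_nonneg hr.1.le e
  rw [restrict_Ioo_eq_restrict_Ioc, ← ofReal_integral_eq_lintegral_ofReal hi hnn,
    ← intervalIntegral.integral_of_le hs, integral_rpow (Or.inl he),
    zero_rpow (by linarith), sub_zero]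

/-- The lower integral of a power over `(r, ∞)`. -/
theorem lintegral_Ioi_rpow {e r : ℝ} (he : e < -1) (hr : 0 < r) :
    ∫⁻ s in Ioi r, ENNReal.ofReal (s ^ e) = ENNReal.ofReal (-r ^ (e + 1) / (e + 1)) := by
  have hnn : 0 ≤ᵐ[volume.restrict (Ioi r)] fun s : ℝ => s ^ e := by
    filter_upwards [ae_restrict_mem measurableSet_Ioi] with s hs
    exact rpow_nonneg (hr.trans hs).le e
  rw [← ofReal_integral_eq_lintegral_ofReal (integrableOn_Ioi_rpow_of_lt he hr) hnn,
    integral_Ioi_rpow_of_lt he hr]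

/-- A differentiable function vanishing at the right endpoint is bounded by the lower integral of
the absolute value of its derivative. -/
theorem ofReal_abs_le_lintegral_deriv {u : ℝ → ℝ} {r R : ℝ} (hr : r < R)
    (hu : ∀ t ∈ Ico r R, DifferentiableAt ℝ u t)
    (huR : Filter.Tendsto u (nhdsWithin R (Iio R)) (nhds 0)) :
    ENNReal.ofReal |u r| ≤ ∫⁻ s in Ioo r R, ENNReal.ofReal |deriv u s| := by
  by_cases hfin : ∫⁻ s in Ioo r R, ENNReal.ofReal |deriv u s| = ⊤
  · simp [hfin]
  have hint : IntegrableOn (deriv u) (Ioo r R) := by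
    refine ⟨(measurable_deriv u).aestronglyMeasurable, ?_⟩
    rw [hasFiniteIntegral_iff_norm]
    exact lt_top_iff_ne_top.2 hfin
  have hbound : ∀ b ∈ Ioo r R,
      ENNReal.ofReal |u b - u r| ≤ ∫⁻ s in Ioo r R, ENNReal.ofReal |deriv u s| := by
    intro b hb
    have hsub : Ioc r b ⊆ Ioo r R := fun x hx => ⟨hx.1, hx.2.trans_lt hb.2⟩
    have hftc : ∫ s in r..b, deriv u s = u b - u r := by
      refine intervalIntegral.integral_eq_sub_of_hasDerivAt (fun t ht => ?_)
        ((intervalIntegrable_iff_integrableOn_Ioc_of_le hb.1.le).2 (hint.mono_set hsub))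
      rw [uIcc_of_le hb.1.le] at ht
      exact (hu t ⟨ht.1, ht.2.trans_lt hb.2⟩).hasDerivAt
    rw [← hftc, intervalIntegral.integral_of_le hb.1.le]
    calc ENNReal.ofReal |∫ s in Ioc r b, deriv u s|
        = ‖∫ s in Ioc r b, deriv u s‖ₑ := by rw [← Real.norm_eq_abs, ofReal_norm]
      _ ≤ ∫⁻ s in Ioc r b, ‖deriv u s‖ₑ := enorm_integral_le_lintegral_enorm _
      _ = ∫⁻ s in Ioc r b, ENNReal.ofReal |deriv u s| := by
        simp_rw [← Real.norm_eq_abs, ofReal_norm]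
      _ ≤ _ := lintegral_mono_set hsub
  have hlim : Filter.Tendsto (fun b => ENNReal.ofReal |u b - u r|) (nhdsWithin R (Iio R))
      (nhds (ENNReal.ofReal |0 - u r|)) :=
    ENNReal.tendsto_ofReal (huR.sub_const _).abs
  rw [zero_sub, abs_neg] at hlim
  refine le_of_tendsto hlim ?_
  filter_upwards [Ioo_mem_nhdsLT hr] with b hb using hbound b hb

/-- Hölder's inequality on `(r, R)` with the power weight that is optimal in Hardy's inequality. -/
theorem lintegral_Ioo_rpow_le {g : ℝ → ENNReal} (hg : Measurable g) {r R p α : ℝ} (hr : 0 < r)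
    (hp : 1 ≤ p) (hα : 0 < α - p + 1) :
    (∫⁻ s in Ioo r R, g s) ^ p ≤
      ENNReal.ofReal ((p / (α - p + 1)) ^ (p - 1) * r ^ (-((p - 1) * (α - p + 1) / p))) *
        ∫⁻ s in Ioo r R, g s ^ p * ENNReal.ofReal (s ^ ((p - 1) * (α + 1) / p)) := by
  rcases hp.eq_or_lt with rfl | hp1
  · simp
  have hp0 : 0 < p := by linarith
  have hpq : p.HolderConjugate (p / (p - 1)) := Real.HolderConjugate.conjExponent hp1
  have hp1' : p - 1 ≠ 0 := by linarith
  set a : ℝ := (p - 1) * (α + 1) / p ^ 2 with ha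
  have hsplit : ∫⁻ s in Ioo r R, g s =
      ∫⁻ s in Ioo r R, ((fun s => g s * ENNReal.ofReal (s ^ a)) *
        fun s => ENNReal.ofReal (s ^ (-a))) s := by
    refine setLIntegral_congr_fun measurableSet_Ioo fun s hs => ?_
    have hs0 : 0 < s := hr.trans hs.1
    simp only [Pi.mul_apply]
    rw [mul_assoc, ← ENNReal.ofReal_mul (by positivity), ← rpow_add hs0]
    simp
  have hfirst : ∫⁻ s in Ioo r R, (g s * ENNReal.ofReal (s ^ a)) ^ p =
      ∫⁻ s in Ioo r R, g s ^ p * ENNReal.ofReal (s ^ ((p - 1) * (α + 1) / p)) := by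
    refine setLIntegral_congr_fun measurableSet_Ioo fun s hs => ?_
    have hs0 : 0 < s := hr.trans hs.1
    rw [ENNReal.mul_rpow_of_nonneg _ _ hp0.le, ENNReal.ofReal_rpow_of_nonneg (by positivity) hp0.le,
      ← rpow_mul hs0.le]
    congr 3
    rw [ha]
    field_simp
  have hsecond : ∫⁻ s in Ioo r R, ENNReal.ofReal (s ^ (-a)) ^ (p / (p - 1)) ≤
      ENNReal.ofReal (p / (α - p + 1) * r ^ (-((α - p + 1) / p))) := by
    have he : -((α + 1) / p) < -1 := by
      rw [neg_lt_neg_iff, one_lt_div hp0]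
      linarith
    calc ∫⁻ s in Ioo r R, ENNReal.ofReal (s ^ (-a)) ^ (p / (p - 1))
        = ∫⁻ s in Ioo r R, ENNReal.ofReal (s ^ (-((α + 1) / p))) := by
          refine setLIntegral_congr_fun measurableSet_Ioo fun s hs => ?_
          have hs0 : 0 < s := hr.trans hs.1
          rw [ENNReal.ofReal_rpow_of_nonneg (by positivity) hpq.symm.nonneg, ← rpow_mul hs0.le]
          congr 2
          rw [ha]
          field_simp
      _ ≤ ∫⁻ s in Ioi r, ENNReal.ofReal (s ^ (-((α + 1) / p))) :=
          lintegral_mono_set Ioo_subset_Ioi_self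
      _ = _ := by
          have hexp : -((α + 1) / p) + 1 = -((α - p + 1) / p) := by
            field_simp
            ring
          rw [lintegral_Ioi_rpow he hr, hexp, neg_div_neg_eq, div_div_eq_mul_div]
          congr 1
          ring
  have hholder := ENNReal.lintegral_mul_le_Lp_mul_Lq (volume.restrict (Ioo r R)) hpq
    (f := fun s => g s * ENNReal.ofReal (s ^ a)) (g := fun s => ENNReal.ofReal (s ^ (-a)))
    (by fun_prop) (by fun_prop)
  rw [← hsplit, hfirst] at hholder
  calc (∫⁻ s in Ioo r R, g s) ^ p
      ≤ ((∫⁻ s in Ioo r R, g s ^ p * ENNReal.ofReal (s ^ ((p - 1) * (α + 1) / p))) ^ (1 / p) *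
        (ENNReal.ofReal (p / (α - p + 1) * r ^ (-((α - p + 1) / p)))) ^ (1 / (p / (p - 1)))) ^ p := by
        refine ENNReal.rpow_le_rpow (hholder.trans ?_) hp0.le
        gcongr
    _ = _ := by
        rw [ENNReal.mul_rpow_of_nonneg _ _ hp0.le, ← ENNReal.rpow_mul, ← ENNReal.rpow_mul,
          one_div_mul_cancel hp0.ne', ENNReal.rpow_one, mul_comm]
        congr 1
        rw [show 1 / (p / (p - 1)) * p = p - 1 by field_simp,
          ENNReal.ofReal_rpow_of_nonneg (by positivity) (by linarith),
          mul_rpow (by positivity) (by positivity), ← rpow_mul hr.le]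
        congr 3
        ring

/-- Tonelli's theorem on the triangle `0 < r < s < R`. -/
theorem lintegral_Ioo_lintegral_Ioo_swap {w h : ℝ → ENNReal} (hw : Measurable w)
    (hh : Measurable h) (R : ℝ) :
    ∫⁻ r in Ioo 0 R, w r * ∫⁻ s in Ioo r R, h s =
      ∫⁻ s in Ioo 0 R, h s * ∫⁻ r in Ioo 0 s, w r := by
  let T : Set (ℝ × ℝ) := {z | z.1 < z.2}
  have hT : MeasurableSet T := measurableSet_lt measurable_fst measurable_snd
  let F : ℝ × ℝ → ENNReal := T.indicator fun z => w z.1 * h z.2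
  have hF : Measurable F :=
    ((hw.comp measurable_fst).mul (hh.comp measurable_snd)).indicator hT
  have hleft : ∀ r ∈ Ioo 0 R,
      w r * ∫⁻ s in Ioo r R, h s = ∫⁻ s in Ioo 0 R, F (r, s) := by
    intro r hr
    have hset : Ioo r R = Ioi r ∩ Ioo 0 R := by
      ext x
      simp only [mem_Ioo, mem_inter_iff, mem_Ioi]
      exact ⟨fun hx => ⟨hx.1, hr.1.trans hx.1, hx.2⟩, fun hx => ⟨hx.1, hx.2.2⟩⟩
    rw [hset, ← setLIntegral_indicator measurableSet_Ioi,
      ← lintegral_const_mul _ (hh.indicator measurableSet_Ioi)]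
    refine lintegral_congr fun s => ?_
    by_cases hs : r < s <;> simp [F, T, hs]
  have hright : ∀ s ∈ Ioo 0 R,
      h s * ∫⁻ r in Ioo 0 s, w r = ∫⁻ r in Ioo 0 R, F (r, s) := by
    intro s hs
    have hset : Ioo 0 s = Iio s ∩ Ioo 0 R := by
      ext x
      simp only [mem_Ioo, mem_inter_iff, mem_Iio]
      exact ⟨fun hx => ⟨hx.2, hx.1, hx.2.trans hs.2⟩, fun hx => ⟨hx.2.1, hx.1⟩⟩
    rw [hset, ← setLIntegral_indicator measurableSet_Iio,
      ← lintegral_const_mul _ (hw.indicator measurableSet_Iio)]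
    refine lintegral_congr fun r => ?_
    by_cases hr : r < s <;> simp [F, T, hr, mul_comm]
  rw [setLIntegral_congr_fun measurableSet_Ioo hleft,
    setLIntegral_congr_fun measurableSet_Ioo hright]
  exact lintegral_lintegral_swap hF.aemeasurable

/-- Hardy's inequality for the operator `g ↦ ∫_r^R g`. -/
theorem lintegral_hardy {g : ℝ → ENNReal} (hg : Measurable g) {R p α : ℝ}
    (hp : 1 ≤ p) (hα : 0 < α - p + 1) :
    ∫⁻ r in Ioo 0 R, (∫⁻ s in Ioo r R, g s) ^ p * ENNReal.ofReal (r ^ (α - p)) ≤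
      ENNReal.ofReal ((p / (α - p + 1)) ^ p) *
        ∫⁻ s in Ioo 0 R, g s ^ p * ENNReal.ofReal (s ^ α) := by
  have hp0 : 0 < p := by linarith
  set β : ℝ := α - p + 1 with hβ
  set K : ℝ := (p / β) ^ (p - 1) with hK
  have hK0 : 0 ≤ K := by positivity
  let w : ℝ → ENNReal := fun r => ENNReal.ofReal (K * r ^ (β / p - 1))
  let h : ℝ → ENNReal := fun s => g s ^ p * ENNReal.ofReal (s ^ ((p - 1) * (α + 1) / p))
  calc ∫⁻ r in Ioo 0 R, (∫⁻ s in Ioo r R, g s) ^ p * ENNReal.ofReal (r ^ (α - p))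
      ≤ ∫⁻ r in Ioo 0 R, w r * ∫⁻ s in Ioo r R, h s := by
        refine setLIntegral_mono' measurableSet_Ioo fun r hr => ?_
        have hexp : -((p - 1) * β / p) + (α - p) = β / p - 1 := by
          rw [hβ]
          field_simp
          ring
        refine (mul_le_mul_left (lintegral_Ioo_rpow_le hg hr.1 hp hα) _).trans_eq ?_
        rw [mul_right_comm, ← ENNReal.ofReal_mul (mul_nonneg hK0 (rpow_nonneg hr.1.le _)),
          mul_assoc, ← rpow_add hr.1, hexp]
    _ = ∫⁻ s in Ioo 0 R, h s * ∫⁻ r in Ioo 0 s, w r :=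
        lintegral_Ioo_lintegral_Ioo_swap (by fun_prop) (by fun_prop) R
    _ = ∫⁻ s in Ioo 0 R, ENNReal.ofReal ((p / β) ^ p) * (g s ^ p * ENNReal.ofReal (s ^ α)) := by
        refine setLIntegral_congr_fun measurableSet_Ioo fun s hs => ?_
        have he : -1 < β / p - 1 := by
          have : 0 < β / p := by positivity
          linarith
        have hexp : (p - 1) * (α + 1) / p + β / p = α := by
          rw [hβ]
          field_simp
          ring
        have hpow : (p / β) ^ p = K * (p / β) := by
          rw [hK, ← rpow_add_one (by positivity)]
          simp
        simp only [w, h, ENNReal.ofReal_mul hK0]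
        rw [lintegral_const_mul _ (by fun_prop), lintegral_Ioo_zero_rpow he hs.1.le,
          ← ENNReal.ofReal_mul hK0, mul_assoc,
          ← ENNReal.ofReal_mul (rpow_nonneg hs.1.le _), mul_left_comm (ENNReal.ofReal _),
          ← ENNReal.ofReal_mul (by positivity), sub_add_cancel, hpow]
        congr 2
        rw [← hexp, rpow_add hs.1, hexp]
        field_simp
    _ = _ := lintegral_const_mul _ (by fun_prop)

/-- Sharp one-dimensional Hardy inequality for functions vanishing at `R`. -/
theorem stmt_5 (R p α : ℝ) (hR : 0 < R) (hp : 1 ≤ p) (hα : 0 < α - p + 1)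
    (u u' : ℝ → ℝ)
    (hderiv : ∀ t ∈ Ioo (0:ℝ) R, HasDerivAt u (u' t) t)
    (huR : Filter.Tendsto u (nhdsWithin R (Iio R)) (nhds 0)) :
    (∫⁻ r in Ioo (0:ℝ) R, ENNReal.ofReal (|u r| ^ p * r ^ (α - p))) ^ (1/p)
      ≤ ENNReal.ofReal (p / (α - p + 1)) *
        (∫⁻ r in Ioo (0:ℝ) R, ENNReal.ofReal (|u' r| ^ p * r ^ α)) ^ (1/p) := by
  have hp0 : 0 < p := by linarith
  have hleft : ∫⁻ r in Ioo (0:ℝ) R, ENNReal.ofReal (|u r| ^ p * r ^ (α - p)) ≤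
      ∫⁻ r in Ioo 0 R, (∫⁻ s in Ioo r R, ENNReal.ofReal |deriv u s|) ^ p *
        ENNReal.ofReal (r ^ (α - p)) := by
    refine setLIntegral_mono' measurableSet_Ioo fun r hr => ?_
    rw [ENNReal.ofReal_mul (by positivity), ← ENNReal.ofReal_rpow_of_nonneg (abs_nonneg _) hp0.le]
    gcongr
    exact ofReal_abs_le_lintegral_deriv hr.2
      (fun t ht => (hderiv t ⟨hr.1.trans_le ht.1, ht.2⟩).differentiableAt) huR
  have hright : ∫⁻ r in Ioo (0:ℝ) R, ENNReal.ofReal (|u' r| ^ p * r ^ α) =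
      ∫⁻ s in Ioo 0 R, ENNReal.ofReal |deriv u s| ^ p * ENNReal.ofReal (s ^ α) := by
    refine setLIntegral_congr_fun measurableSet_Ioo fun r hr => ?_
    rw [ENNReal.ofReal_mul (by positivity), ← ENNReal.ofReal_rpow_of_nonneg (abs_nonneg _) hp0.le,
      (hderiv r hr).deriv]
  have hmain := hleft.trans
    (lintegral_hardy (measurable_deriv u).norm.ennreal_ofReal hp hα)
  rw [hright]
  refine (ENNReal.rpow_le_rpow hmain (by positivity)).trans_eq ?_
  rw [ENNReal.mul_rpow_of_nonneg _ _ (by positivity),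
    ENNReal.ofReal_rpow_of_nonneg (by positivity) (by positivity), ← rpow_mul (by positivity),
    mul_one_div_cancel hp0.ne', rpow_one]
  rfl
end

section
/- Let p>1 and r>0. There exists C₀ = C₀(p,r) such that for every positive measurable f on (1,∞) with ∫₁^∞ f(s)^p s^{2p-1} ds ≤ 1, setting F(t) = ∫₁^t ∫_z^∞ f(s) ds dz, one has ∫₁^∞ exp(r F(t)^{q}) t^{-(r+1)} dt ≤ C₀, where q = p/(p-1). -/
open Real MeasureTheory Set

theorem one_sub_rpow_le {s L : ℝ} (hs : 0 < s) (hL : 0 ≤ L) (hL1 : L ≤ 1) :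
    (1 - L) ^ s ≤ 1 - min 1 s * L := by
  rcases hL1.eq_or_lt with rfl | hL1
  · simp [Real.zero_rpow hs.ne']
  have h1 : (1 - L) ^ s ≤ (1 - L) ^ (min 1 s) :=
    Real.rpow_le_rpow_of_exponent_ge (by linarith) (by linarith) (min_le_right _ _)
  have h2 := rpow_one_add_le_one_add_mul_self (s := -L) (by linarith) (p := min 1 s)
    (by positivity) (min_le_left _ _)
  rw [← sub_eq_add_neg] at h2
  linarith

theorem one_sub_rpow_neg_le {s θ : ℝ} (hs : 0 < s) (hθ : 0 ≤ θ) (hθ1 : θ ≤ 1 / 2) :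
    (1 - θ) ^ (-s) ≤ 1 + 2 * s * Real.exp s * θ := by
  have h0 : 0 < 1 - θ := by linarith
  have h1 : (1 - θ)⁻¹ ≤ Real.exp (2 * θ) := by
    calc (1 - θ)⁻¹ ≤ 2 * θ + 1 := by
          rw [inv_le_iff_one_le_mul₀ h0]; nlinarith
      _ ≤ _ := Real.add_one_le_exp _
  have h2 : (1 - θ) ^ (-s) ≤ Real.exp (2 * θ * s) := by
    rw [Real.rpow_neg h0.le, ← Real.inv_rpow h0.le, Real.exp_mul]
    exact Real.rpow_le_rpow (by positivity) h1 hs.le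
  have h3 := Real.add_one_le_exp (-(2 * θ * s))
  have h4 : Real.exp (2 * θ * s) ≤ Real.exp s := Real.exp_le_exp.2 (by nlinarith)
  have h5 : Real.exp (2 * θ * s) * Real.exp (-(2 * θ * s)) = 1 := by
    rw [← Real.exp_add]; simp
  have h6 := mul_le_mul_of_nonneg_left h3 (Real.exp_pos (2 * θ * s)).le
  have h7 := mul_le_mul_of_nonneg_left h4 (show 0 ≤ 2 * θ * s by positivity)
  nlinarith

theorem add_rpow_le_of_weight {q θ u v : ℝ} (hq : 1 ≤ q) (hθ : 0 < θ) (hθ1 : θ < 1)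
    (hu : 0 ≤ u) (hv : 0 ≤ v) :
    (u + v) ^ q ≤ (1 - θ) ^ (1 - q) * u ^ q + θ ^ (1 - q) * v ^ q := by
  have h0 : 0 < 1 - θ := by linarith
  have h := (convexOn_rpow hq).2 (x := u / (1 - θ)) (y := v / θ) (mem_Ici.2 (by positivity))
    (mem_Ici.2 (by positivity)) h0.le hθ.le (by ring)
  simp only [smul_eq_mul] at h
  rw [mul_div_cancel₀ _ h0.ne', mul_div_cancel₀ _ hθ.ne', Real.div_rpow hu h0.le,
    Real.div_rpow hv hθ.le] at h
  rw [Real.rpow_sub h0, Real.rpow_sub hθ, Real.rpow_one, Real.rpow_one]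
  simpa only [div_mul_eq_mul_div, mul_div_assoc] using h

theorem exists_gap_bound {p q : ℝ} (hpq : p.HolderConjugate q) :
    ∃ K > 0, ∀ L T D lam F₁ F₂ : ℝ, 0 ≤ L → L ≤ 1 → 0 ≤ T → 0 ≤ D → 0 ≤ lam → 0 ≤ F₁ → 0 ≤ F₂ →
      F₁ ≤ (1 - L) ^ (1 / p) * T ^ (1 / q) →
      F₂ ≤ T ^ (1 / q) + L ^ (1 / p) * D ^ (1 / q) →
      T - lam ≤ F₁ ^ q → T + D - lam ≤ F₂ ^ q →
      T ≤ K * lam ∨ D ≤ K * lam := by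
  have hq := hpq.symm.lt
  have hq0 := hpq.symm.pos
  obtain ⟨s, hs⟩ : ∃ s, s = q - 1 := ⟨_, rfl⟩
  have hs0 : 0 < s := by linarith
  have hps : 1 / p * q = s := by
    rw [hs, one_div_mul_eq_div]; exact hpq.symm.div_conj_eq_sub_one
  set c := min 1 s with hc
  have hc0 : 0 < c := by positivity
  set m : ℝ := 2 ^ (1 / s) with hm
  have hm0 : 0 < m := by positivity
  have hms : m ^ s = 2 := by
    rw [hm, ← Real.rpow_mul (by norm_num), one_div_mul_cancel hs0.ne', Real.rpow_one]
  refine ⟨2 + 4 * s * Real.exp s * m / c + 2 * m / c, by positivity, ?_⟩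
  intro L T D lam F₁ F₂ hL hL1 hT hD hlam hF₁ hF₂ h1 h2 h3 h4
  have root : ∀ {x : ℝ}, 0 ≤ x → (x ^ (1 / q)) ^ q = x := fun {x} hx => by
    rw [← Real.rpow_mul hx, one_div_mul_cancel hq0.ne', Real.rpow_one]
  have h5 : T - lam ≤ (1 - L) ^ s * T := by
    refine h3.trans ((Real.rpow_le_rpow hF₁ h1 hq0.le).trans_eq ?_)
    rw [Real.mul_rpow (by apply Real.rpow_nonneg; linarith) (by positivity), root hT,
      ← Real.rpow_mul (by linarith), hps]
  have h6 : c * L * T ≤ lam := by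
    nlinarith [mul_le_mul_of_nonneg_right (one_sub_rpow_le hs0 hL hL1) hT]
  have h7 : T + D - lam ≤ (T ^ (1 / q) + L ^ (1 / p) * D ^ (1 / q)) ^ q :=
    h4.trans (Real.rpow_le_rpow hF₂ h2 hq0.le)
  have hA : 0 ≤ 4 * s * Real.exp s * m / c * lam := by positivity
  have hB : 0 ≤ 2 * m / c * lam := by positivity
  rcases hL.eq_or_lt with rfl | hL0
  · right
    rw [Real.zero_rpow (by simpa using hpq.ne_zero), zero_mul, add_zero, root hT] at h7
    nlinarith
  have h8 : L * T ≤ lam / c := by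
    rw [le_div_iff₀ hc0]; linarith
  rcases le_or_gt (m * L) (1 / 2) with hmL | hmL
  · right
    have h9 := add_rpow_le_of_weight hq.le (mul_pos hm0 hL0) (by linarith)
      (show 0 ≤ T ^ (1 / q) by positivity) (show 0 ≤ L ^ (1 / p) * D ^ (1 / q) by positivity)
    rw [Real.mul_rpow (x := L ^ (1 / p)) (by positivity) (by positivity), root hT, root hD,
      ← Real.rpow_mul hL, hps, show 1 - q = -s by linarith, Real.rpow_neg (by positivity : 0 ≤ m * L),
      Real.mul_rpow hm0.le hL, hms] at h9
    have hLs : 0 < L ^ s := by positivity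
    have h10 : (2 * L ^ s)⁻¹ * (L ^ s * D) = D / 2 := by field_simp
    rw [h10] at h9
    have h11 := mul_le_mul_of_nonneg_right
      (one_sub_rpow_neg_le hs0 (mul_pos hm0 hL0).le hmL) hT
    have h12 := mul_le_mul_of_nonneg_left h8 (show 0 ≤ 2 * s * Real.exp s * m by positivity)
    have h13 : D / 2 ≤ lam + 2 * s * Real.exp s * m * (lam / c) := by nlinarith
    calc D ≤ 2 * (lam + 2 * s * Real.exp s * m * (lam / c)) := by linarith
      _ = (2 + 4 * s * Real.exp s * m / c) * lam := by ring
      _ ≤ _ := by nlinarith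
  · left
    have h9 : T ≤ 2 * m * (L * T) := by nlinarith
    have h10 := mul_le_mul_of_nonneg_left h8 (show 0 ≤ 2 * m by positivity)
    calc T ≤ 2 * m * (lam / c) := by linarith
      _ = 2 * m / c * lam := by ring
      _ ≤ _ := by nlinarith

theorem lintegral_le_weighted_holder {p q : ℝ} (hpq : p.HolderConjugate q) (γ : ℝ)
    {h : ℝ → ENNReal} (hh : Measurable h) {S : Set ℝ} (hS : MeasurableSet S) (hS0 : S ⊆ Ioi 0) :
    ∫⁻ s in S, h s ≤ (∫⁻ s in S, h s ^ p * ENNReal.ofReal (s ^ (γ * (p - 1)))) ^ (1 / p) *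
      (∫⁻ s in S, ENNReal.ofReal (s ^ (-γ))) ^ (1 / q) := by
  have hp0 := hpq.pos
  have hq0 := hpq.symm.pos
  have key := ENNReal.lintegral_mul_le_Lp_mul_Lq (volume.restrict S) hpq
    (f := fun s => h s * ENNReal.ofReal (s ^ (γ / q)))
    (g := fun s => ENNReal.ofReal (s ^ (-(γ / q))))
    (by fun_prop) (by fun_prop)
  refine (le_of_eq ?_).trans (key.trans (le_of_eq ?_))
  · refine setLIntegral_congr_fun hS fun s hs => ?_
    have hs0 : 0 < s := hS0 hs
    simp only [Pi.mul_apply]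
    rw [mul_assoc, ← ENNReal.ofReal_mul (by positivity), ← Real.rpow_add hs0]
    simp
  · congr 2
    · refine setLIntegral_congr_fun hS fun s hs => ?_
      have hs0 : 0 < s := hS0 hs
      rw [ENNReal.mul_rpow_of_nonneg _ _ hp0.le, ENNReal.ofReal_rpow_of_nonneg (by positivity) hp0.le,
        ← Real.rpow_mul hs0.le, ← hpq.div_conj_eq_sub_one]
      congr 3
      ring
    · refine setLIntegral_congr_fun hS fun s hs => ?_
      have hs0 : 0 < s := hS0 hs
      rw [ENNReal.ofReal_rpow_of_nonneg (by positivity) hq0.le,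
        ← Real.rpow_mul hs0.le]
      congr 2
      field_simp

theorem lintegral_tail_rpow_mul_le {p q : ℝ} (hpq : p.HolderConjugate q)
    {h : ℝ → ENNReal} (hh : Measurable h) {z : ℝ} (hz : 0 < z) :
    (∫⁻ s in Ioi z, h s) ^ p * ENNReal.ofReal (z ^ (p - 1)) ≤
      ∫⁻ s in Ioi z, h s ^ p * ENNReal.ofReal (s ^ (2 * (p - 1))) := by
  have hp0 := hpq.pos
  have hp1 := hpq.lt
  have h1 := lintegral_le_weighted_holder hpq 2 hh (measurableSet_Ioi (a := z))
    (Ioi_subset_Ioi hz.le)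
  have h2 : ∫⁻ s in Ioi z, ENNReal.ofReal (s ^ (-2 : ℝ)) = ENNReal.ofReal z⁻¹ := by
    rw [← ofReal_integral_eq_lintegral_ofReal (integrableOn_Ioi_rpow_of_lt (by norm_num) hz),
      integral_Ioi_rpow_of_lt (by norm_num) hz]
    · norm_num [Real.rpow_neg_one]
    · filter_upwards [ae_restrict_mem measurableSet_Ioi] with s hs
      exact Real.rpow_nonneg (hz.trans hs).le _
  rw [h2] at h1
  calc _ ≤ ((∫⁻ s in Ioi z, h s ^ p * ENNReal.ofReal (s ^ (2 * (p - 1)))) ^ (1 / p) *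
          ENNReal.ofReal z⁻¹ ^ (1 / q)) ^ p * ENNReal.ofReal (z ^ (p - 1)) := by gcongr
    _ = _ := by
      rw [ENNReal.mul_rpow_of_nonneg _ _ hp0.le, ← ENNReal.rpow_mul, ← ENNReal.rpow_mul,
        one_div_mul_cancel hp0.ne', ENNReal.rpow_one, one_div_mul_eq_div,
        hpq.div_conj_eq_sub_one, ENNReal.ofReal_rpow_of_nonneg (by positivity) (by linarith),
        mul_assoc, ← ENNReal.ofReal_mul (by positivity), ← Real.mul_rpow (by positivity) hz.le,
        inv_mul_cancel₀ hz.ne']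
      simp

theorem measurable_lintegral_Ioi (h : ℝ → ENNReal) : Measurable fun z => ∫⁻ s in Ioi z, h s :=
  Antitone.measurable fun _ _ hab => lintegral_mono_set (Ioi_subset_Ioi hab)

theorem lintegral_tail_hardy {p q : ℝ} (hpq : p.HolderConjugate q)
    {h : ℝ → ENNReal} (hh : Measurable h) :
    ∫⁻ z in Ioi (1 : ℝ), (∫⁻ s in Ioi z, h s) ^ p * ENNReal.ofReal (z ^ (p - 1)) ≤
      ∫⁻ s in Ioi (1 : ℝ), h s ^ p * ENNReal.ofReal (s ^ (2 * p - 1)) := by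
  set k : ℝ → ENNReal := fun s => h s ^ p * ENNReal.ofReal (s ^ (2 * (p - 1))) with hk
  have hkm : Measurable k := by fun_prop
  calc _ ≤ ∫⁻ z in Ioi (1 : ℝ), ∫⁻ s in Ioi z, k s :=
        setLIntegral_mono' measurableSet_Ioi fun z hz =>
          lintegral_tail_rpow_mul_le hpq hh (one_pos.trans hz)
    _ = ∫⁻ z in Ioi (1 : ℝ), ∫⁻ s in Ioi (1 : ℝ), (Iio s).indicator (fun _ => k s) z := by
        refine setLIntegral_congr_fun measurableSet_Ioi fun z hz => ?_
        rw [← inter_eq_left.2 (Ioi_subset_Ioi (le_of_lt hz)), ← Measure.restrict_restrict measurableSet_Ioi,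
          ← lintegral_indicator measurableSet_Ioi]
        rfl
    _ = ∫⁻ s in Ioi (1 : ℝ), ∫⁻ z in Ioi (1 : ℝ), (Iio s).indicator (fun _ => k s) z := by
        refine lintegral_lintegral_swap (Measurable.aemeasurable ?_)
        exact (hkm.comp measurable_snd).indicator (measurableSet_lt measurable_fst measurable_snd)
    _ ≤ _ := by
        refine setLIntegral_mono' measurableSet_Ioi fun s hs => ?_
        have hs0 : 0 < s := one_pos.trans hs
        rw [lintegral_indicator measurableSet_Iio, lintegral_const, Measure.restrict_restrict measurableSet_Iio,
          Measure.restrict_apply_univ, Iio_inter_Ioi, Real.volume_Ioo, hk]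
        simp only
        rw [mul_assoc, ← ENNReal.ofReal_mul (by positivity)]
        gcongr
        calc s ^ (2 * (p - 1)) * (s - 1) ≤ s ^ (2 * (p - 1)) * s := by gcongr; linarith
          _ = s ^ (2 * p - 1) := by
            rw [← Real.rpow_add_one hs0.ne']; congr 1; ring

theorem setLIntegral_inv {a b : ℝ} (ha : 0 < a) (hab : a ≤ b) :
    ∫⁻ s in Ico a b, ENNReal.ofReal (s ^ (-1 : ℝ)) = ENNReal.ofReal (Real.log b - Real.log a) := by
  have hb := ha.trans_le hab
  rw [setLIntegral_congr Ico_ae_eq_Ioc]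
  simp_rw [Real.rpow_neg_one]
  rw [← ofReal_integral_eq_lintegral_ofReal, ← intervalIntegral.integral_of_le hab,
    integral_inv_of_pos ha hb, Real.log_div hb.ne' ha.ne']
  · rw [← IntegrableOn, ← intervalIntegrable_iff_integrableOn_Ioc_of_le hab]
    exact intervalIntegrable_inv_iff.2 (Or.inr (notMem_uIcc_of_lt ha hb))
  · filter_upwards [ae_restrict_mem measurableSet_Ioc] with s hs
    exact inv_nonneg.2 (ha.trans hs.1).le

theorem lintegral_Ico_le_of_energy {p q : ℝ} (hpq : p.HolderConjugate q)
    {g : ℝ → ENNReal} (hg : Measurable g) {a b L : ℝ} (ha : 0 < a) (hab : a ≤ b) (hL : 0 ≤ L)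
    (hE : ∫⁻ z in Ico a b, g z ^ p * ENNReal.ofReal (z ^ (p - 1)) ≤ ENNReal.ofReal L) :
    ∫⁻ z in Ico a b, g z ≤
      ENNReal.ofReal (L ^ (1 / p) * (Real.log b - Real.log a) ^ (1 / q)) := by
  have hp0 := hpq.pos
  have hq0 := hpq.symm.pos
  have h1 := lintegral_le_weighted_holder hpq 1 hg (measurableSet_Ico (a := a) (b := b))
    (fun s hs => ha.trans_le hs.1)
  have hlog : 0 ≤ Real.log b - Real.log a := sub_nonneg.2 (Real.log_le_log ha hab)
  rw [setLIntegral_inv ha hab, one_mul] at h1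
  rw [ENNReal.ofReal_mul (by positivity), ← ENNReal.ofReal_rpow_of_nonneg hL (by positivity),
    ← ENNReal.ofReal_rpow_of_nonneg hlog (by positivity)]
  exact h1.trans (by gcongr)

theorem exists_energy_split {p q : ℝ} (hpq : p.HolderConjugate q)
    {g : ℝ → ENNReal} (hg : Measurable g)
    (hE : ∫⁻ z in Ioi (1 : ℝ), g z ^ p * ENNReal.ofReal (z ^ (p - 1)) ≤ 1)
    {a b : ℝ} (ha : 1 ≤ a) (hab : a ≤ b) :
    ∃ L : ℝ, 0 ≤ L ∧ L ≤ 1 ∧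
      ∫⁻ z in Ico 1 a, g z ≤ ENNReal.ofReal ((1 - L) ^ (1 / p) * (Real.log a) ^ (1 / q)) ∧
      ∫⁻ z in Ico 1 b, g z ≤ ENNReal.ofReal ((Real.log a) ^ (1 / q) +
        L ^ (1 / p) * (Real.log b - Real.log a) ^ (1 / q)) := by
  have hp0 := hpq.pos
  have hq0 := hpq.symm.pos
  have ha0 : 0 < a := one_pos.trans_le ha
  have hlog : 0 ≤ Real.log b - Real.log a := sub_nonneg.2 (Real.log_le_log ha0 hab)
  have hloga := Real.log_nonneg ha
  have hunion : ∀ w : ℝ → ENNReal, ∫⁻ z in Ico 1 b, w z =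
      (∫⁻ z in Ico 1 a, w z) + ∫⁻ z in Ico a b, w z := fun w => by
    rw [← Ico_union_Ico_eq_Ico ha hab, lintegral_union measurableSet_Ico]
    exact Set.disjoint_left.2 fun x hx hy => absurd hx.2 (not_lt.2 hy.1)
  have hsum := hunion fun z => g z ^ p * ENNReal.ofReal (z ^ (p - 1))
  have htot : ∫⁻ z in Ico 1 b, g z ^ p * ENNReal.ofReal (z ^ (p - 1)) ≤ 1 := by
    rw [setLIntegral_congr Ioo_ae_eq_Ico.symm]
    exact (lintegral_mono_set Ioo_subset_Ioi_self).trans hE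
  rw [hsum] at htot
  set A := ∫⁻ z in Ico 1 a, g z ^ p * ENNReal.ofReal (z ^ (p - 1))
  set B := ∫⁻ z in Ico a b, g z ^ p * ENNReal.ofReal (z ^ (p - 1))
  have hB1 : B ≤ 1 := le_add_self.trans htot
  have hBtop : B ≠ ⊤ := ne_top_of_le_ne_top ENNReal.one_ne_top hB1
  have hL1 : B.toReal ≤ 1 := by simpa using ENNReal.toReal_mono ENNReal.one_ne_top hB1
  have hA : A ≤ ENNReal.ofReal (1 - B.toReal) := by
    rw [ENNReal.ofReal_sub _ ENNReal.toReal_nonneg, ENNReal.ofReal_toReal hBtop, ENNReal.ofReal_one]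
    exact ENNReal.le_sub_of_add_le_right hBtop htot
  have h1 := lintegral_Ico_le_of_energy hpq hg one_pos ha (sub_nonneg.2 hL1) hA
  have h2 := lintegral_Ico_le_of_energy hpq hg ha0 hab ENNReal.toReal_nonneg
    (ENNReal.ofReal_toReal hBtop).ge
  rw [Real.log_one, sub_zero] at h1
  refine ⟨B.toReal, ENNReal.toReal_nonneg, hL1, h1, ?_⟩
  rw [hunion, ENNReal.ofReal_add (by positivity) (by positivity)]
  refine add_le_add (h1.trans (ENNReal.ofReal_le_ofReal ?_)) h2
  exact mul_le_of_le_one_left (by positivity)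
    (Real.rpow_le_one (sub_nonneg.2 hL1) (by linarith [@ENNReal.toReal_nonneg B]) (by positivity))

theorem exists_level_set_cover {p q : ℝ} (hpq : p.HolderConjugate q) :
    ∃ K > 0, ∀ g : ℝ → ENNReal, Measurable g →
      (∫⁻ z in Ioi (1 : ℝ), g z ^ p * ENNReal.ofReal (z ^ (p - 1)) ≤ 1) →
      ∀ F : ℝ → ℝ, (∀ t > 1, 0 ≤ F t) → (∀ t > 1, ENNReal.ofReal (F t) ≤ ∫⁻ z in Ico 1 t, g z) →
      ∀ lam : ℝ, 0 ≤ lam → ∃ U : Set ℝ, MeasurableSet U ∧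
        (∀ t > 1, Real.log t - F t ^ q ≤ lam → t ∈ U) ∧
        ∫⁻ t in U, ENNReal.ofReal (t ^ (-1 : ℝ)) ≤ ENNReal.ofReal (K * lam) := by
  have hp0 := hpq.pos
  have hq0 := hpq.symm.pos
  obtain ⟨K, hK, hgap⟩ := exists_gap_bound hpq
  refine ⟨3 * K, by positivity, ?_⟩
  intro g hg hE F hF0 hF lam hlam
  have hpair : ∀ a b : ℝ, 1 < a → a ≤ b → Real.log a - F a ^ q ≤ lam →
      Real.log b - F b ^ q ≤ lam →
      Real.log a ≤ K * lam ∨ Real.log b - Real.log a ≤ K * lam := by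
    intro a b ha hab hEa hEb
    obtain ⟨L, hL, hL1, h1, h2⟩ := exists_energy_split hpq hg hE ha.le hab
    have hlog : 0 ≤ Real.log b - Real.log a :=
      sub_nonneg.2 (Real.log_le_log (one_pos.trans ha) hab)
    have hloga := Real.log_nonneg ha.le
    have hL' : 0 ≤ 1 - L := sub_nonneg.2 hL1
    refine hgap L (Real.log a) (Real.log b - Real.log a) lam (F a) (F b) hL hL1 hloga hlog hlam
      (hF0 a ha) (hF0 b (ha.trans_le hab)) ?_ ?_ (by linarith) (by linarith)
    · exact (ENNReal.ofReal_le_ofReal_iff (by positivity)).1 ((hF a ha).trans h1)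
    · exact (ENNReal.ofReal_le_ofReal_iff (by positivity)).1 ((hF b (ha.trans_le hab)).trans h2)
  have hKl : 0 ≤ K * lam := by positivity
  obtain ⟨c, hc, hcover⟩ : ∃ c : ℝ, 0 < c ∧ ∀ t > 1, Real.log t - F t ^ q ≤ lam →
      Real.log t ≤ K * lam ∨ |Real.log t - Real.log c| ≤ K * lam := by
    by_cases hex : ∃ c > 1, Real.log c - F c ^ q ≤ lam ∧ K * lam < Real.log c
    · obtain ⟨c, hc, hcE, hcK⟩ := hex
      refine ⟨c, one_pos.trans hc, fun t ht htE => ?_⟩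
      rcases le_total t c with htc | htc
      · refine (hpair t c ht htc htE hcE).imp_right fun h => ?_
        rwa [abs_sub_comm, abs_of_nonneg]
        exact sub_nonneg.2 (Real.log_le_log (one_pos.trans ht) htc)
      · refine Or.inr ?_
        rw [abs_of_nonneg (sub_nonneg.2 (Real.log_le_log (one_pos.trans hc) htc))]
        exact (hpair c t hc htc hcE htE).resolve_left (not_le.2 hcK)
    · push Not at hex
      exact ⟨1, one_pos, fun t ht htE => Or.inl (hex t ht htE)⟩
  refine ⟨Icc 1 (Real.exp (K * lam)) ∪ Icc (c * Real.exp (-(K * lam))) (c * Real.exp (K * lam)),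
    measurableSet_Icc.union measurableSet_Icc, fun t ht htE => ?_, ?_⟩
  · have ht0 : 0 < t := one_pos.trans ht
    refine (hcover t ht htE).imp (fun h => ⟨ht.le, (Real.log_le_iff_le_exp ht0).1 h⟩) fun h => ?_
    rw [abs_le] at h
    constructor
    · rw [← Real.log_le_log_iff (by positivity) ht0, Real.log_mul hc.ne' (Real.exp_pos _).ne',
        Real.log_exp]
      linarith
    · rw [← Real.log_le_log_iff ht0 (by positivity), Real.log_mul hc.ne' (Real.exp_pos _).ne',
        Real.log_exp]
      linarith
  · refine (lintegral_union_le _ _ _).trans ?_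
    rw [setLIntegral_congr Ico_ae_eq_Icc.symm, setLIntegral_congr Ico_ae_eq_Icc.symm,
      setLIntegral_inv one_pos (Real.one_le_exp hKl),
      setLIntegral_inv (by positivity) (by gcongr; linarith),
      Real.log_mul hc.ne' (Real.exp_pos _).ne', Real.log_mul hc.ne' (Real.exp_pos _).ne',
      Real.log_exp, Real.log_exp, Real.log_one, ← ENNReal.ofReal_add (by linarith) (by linarith)]
    exact ENNReal.ofReal_le_ofReal (by linarith)

theorem rpow_le_log_of_energy {p q : ℝ} (hpq : p.HolderConjugate q)
    {g : ℝ → ENNReal} (hg : Measurable g)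
    (hE : ∫⁻ z in Ioi (1 : ℝ), g z ^ p * ENNReal.ofReal (z ^ (p - 1)) ≤ 1)
    {t x : ℝ} (ht : 1 ≤ t) (hx : 0 ≤ x) (hxg : ENNReal.ofReal x ≤ ∫⁻ z in Ico 1 t, g z) :
    x ^ q ≤ Real.log t := by
  have hp0 := hpq.pos
  have hq0 := hpq.symm.pos
  obtain ⟨L, hL, hL1, h1, -⟩ := exists_energy_split hpq hg hE ht le_rfl
  have hlog := Real.log_nonneg ht
  have hL' : 0 ≤ 1 - L := sub_nonneg.2 hL1
  have h2 : x ≤ (1 - L) ^ (1 / p) * Real.log t ^ (1 / q) :=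
    (ENNReal.ofReal_le_ofReal_iff (by positivity)).1 (hxg.trans h1)
  have h3 : x ≤ Real.log t ^ (1 / q) := h2.trans <|
    mul_le_of_le_one_left (by positivity) (Real.rpow_le_one hL' (by linarith) (by positivity))
  rwa [one_div, Real.le_rpow_inv_iff_of_pos hx hlog hq0] at h3

theorem exists_moser_bound {p q r : ℝ} (hpq : p.HolderConjugate q) (hr : 0 < r) :
    ∃ C > 0, ∀ g : ℝ → ENNReal, Measurable g →
      (∫⁻ z in Ioi (1 : ℝ), g z ^ p * ENNReal.ofReal (z ^ (p - 1)) ≤ 1) →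
      ∀ F : ℝ → ℝ, (∀ t > 1, 0 ≤ F t) → (∀ t > 1, ENNReal.ofReal (F t) ≤ ∫⁻ z in Ico 1 t, g z) →
      ∫⁻ t in Ioi (1 : ℝ), ENNReal.ofReal (Real.exp (r * F t ^ q) * t ^ (-(r + 1))) ≤
        ENNReal.ofReal C := by
  obtain ⟨K, hK, hlevel⟩ := exists_level_set_cover hpq
  have hsum : Summable fun n : ℕ => Real.exp (-r) ^ n * (K * (n + 1)) := by
    have hlt : ‖Real.exp (-r)‖ < 1 := by
      rw [Real.norm_of_nonneg (Real.exp_pos _).le]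
      exact Real.exp_lt_one_iff.2 (by linarith)
    refine (((summable_pow_mul_geometric_of_norm_lt_one 1 hlt).add
      (summable_pow_mul_geometric_of_norm_lt_one 0 hlt)).mul_left K).congr fun n => ?_
    ring
  have hnn : ∀ n : ℕ, 0 ≤ Real.exp (-r) ^ n * (K * (n + 1)) := fun n => by positivity
  refine ⟨(∑' n : ℕ, Real.exp (-r) ^ n * (K * (n + 1))) + 1,
    add_pos_of_nonneg_of_pos (tsum_nonneg hnn) one_pos, ?_⟩
  intro g hg hE F hF0 hF
  have hcover := fun n : ℕ => hlevel g hg hE F hF0 hF (n + 1) (by positivity)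
  choose U hUm hU hUint using hcover
  have hpt : ∀ t ∈ Ioi (1 : ℝ), ENNReal.ofReal (Real.exp (r * F t ^ q) * t ^ (-(r + 1))) ≤
      ∑' n : ℕ, (U n).indicator
        (fun t => ENNReal.ofReal (Real.exp (-r) ^ n) * ENNReal.ofReal (t ^ (-1 : ℝ))) t := by
    intro t ht
    have ht0 : 0 < t := one_pos.trans ht
    have hPhi : 0 ≤ Real.log t - F t ^ q := sub_nonneg.2 <|
      rpow_le_log_of_energy hpq hg hE (le_of_lt ht) (hF0 t ht) (hF t ht)
    set n := ⌊Real.log t - F t ^ q⌋₊ with hn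
    have htU : t ∈ U n := hU n t ht (Nat.lt_floor_add_one _).le
    refine le_trans ?_ (ENNReal.le_tsum n)
    rw [indicator_of_mem htU, ← ENNReal.ofReal_mul (by positivity), ← Real.exp_nat_mul,
      Real.rpow_def_of_pos ht0, Real.rpow_def_of_pos ht0, ← Real.exp_add, ← Real.exp_add]
    refine ENNReal.ofReal_le_ofReal (Real.exp_le_exp.2 ?_)
    nlinarith [Nat.floor_le hPhi]
  calc _ ≤ ∫⁻ t in Ioi (1 : ℝ), ∑' n : ℕ, (U n).indicator
        (fun t => ENNReal.ofReal (Real.exp (-r) ^ n) * ENNReal.ofReal (t ^ (-1 : ℝ))) t :=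
        setLIntegral_mono' measurableSet_Ioi hpt
    _ ≤ ∫⁻ t, ∑' n : ℕ, (U n).indicator
        (fun t => ENNReal.ofReal (Real.exp (-r) ^ n) * ENNReal.ofReal (t ^ (-1 : ℝ))) t :=
        setLIntegral_le_lintegral _ _
    _ = ∑' n : ℕ, ENNReal.ofReal (Real.exp (-r) ^ n) *
          ∫⁻ t in U n, ENNReal.ofReal (t ^ (-1 : ℝ)) := by
        rw [lintegral_tsum fun n => ((by fun_prop : Measurable _).indicator (hUm n)).aemeasurable]
        refine tsum_congr fun n => ?_
        rw [lintegral_indicator (hUm n), lintegral_const_mul _ (by fun_prop)]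
    _ ≤ ∑' n : ℕ, ENNReal.ofReal (Real.exp (-r) ^ n * (K * (n + 1))) := by
        refine ENNReal.tsum_le_tsum fun n => ?_
        rw [ENNReal.ofReal_mul (by positivity)]
        gcongr
        exact hUint n
    _ = ENNReal.ofReal (∑' n : ℕ, Real.exp (-r) ^ n * (K * (n + 1))) :=
        (ENNReal.ofReal_tsum_of_nonneg hnn hsum).symm
    _ ≤ _ := ENNReal.ofReal_le_ofReal (by linarith)

/-- Tarsi's lemma: uniform exponential bound for second primitives. -/
theorem stmt_14 (p r : ℝ) (hp : 1 < p) (hr : 0 < r) :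
    ∃ C₀ > 0, ∀ f : ℝ → ℝ, Measurable f → (∀ s ∈ Ioi (1:ℝ), 0 < f s) →
      (∫⁻ s in Ioi (1:ℝ), ENNReal.ofReal (f s ^ p * s ^ (2*p - 1)) ≤ 1) →
      ∫⁻ t in Ioi (1:ℝ),
          ENNReal.ofReal
            (Real.exp (r * (∫ z in Ioo (1:ℝ) t, ∫ s in Ioi z, f s) ^ (p/(p-1)))
              * t ^ (-(r+1)))
        ≤ ENNReal.ofReal C₀ := by
  obtain ⟨C, hC, hbound⟩ := exists_moser_bound (Real.HolderConjugate.conjExponent hp) hr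
  refine ⟨C, hC, fun f hfm hf hE => ?_⟩
  have htail : ∀ z > (1 : ℝ), 0 ≤ ∫ s in Ioi z, f s := fun z hz =>
    setIntegral_nonneg measurableSet_Ioi fun s hs => (hf s (hz.trans hs)).le
  have htail_le : ∀ z > (1 : ℝ), ENNReal.ofReal (∫ s in Ioi z, f s) ≤
      ∫⁻ s in Ioi z, ENNReal.ofReal (f s) := fun z hz => by
    rw [← Real.enorm_of_nonneg (htail z hz)]
    refine (enorm_integral_le_lintegral_enorm _).trans
      (setLIntegral_mono' measurableSet_Ioi fun s hs => ?_)
    rw [Real.enorm_of_nonneg (hf s (hz.trans hs)).le]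
  have hF0 : ∀ t > (1 : ℝ), 0 ≤ ∫ z in Ioo (1 : ℝ) t, ∫ s in Ioi z, f s := fun t _ =>
    setIntegral_nonneg measurableSet_Ioo fun z hz => htail z hz.1
  refine hbound (fun z => ∫⁻ s in Ioi z, ENNReal.ofReal (f s)) (measurable_lintegral_Ioi _) ?_
    (fun t => ∫ z in Ioo (1 : ℝ) t, ∫ s in Ioi z, f s) hF0 fun t ht => ?_
  · refine (lintegral_tail_hardy (Real.HolderConjugate.conjExponent hp)
      hfm.ennreal_ofReal).trans (le_trans (le_of_eq ?_) hE)
    refine setLIntegral_congr_fun measurableSet_Ioi fun s hs => ?_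
    have hfs := (hf s hs).le
    rw [ENNReal.ofReal_rpow_of_nonneg hfs (by linarith), ← ENNReal.ofReal_mul (by positivity)]
  · rw [← Real.enorm_of_nonneg (hF0 t ht), setLIntegral_congr Ioo_ae_eq_Ico.symm]
    refine (enorm_integral_le_lintegral_enorm _).trans
      (setLIntegral_mono' measurableSet_Ioo fun z hz => ?_)
    rw [Real.enorm_of_nonneg (htail z hz.1)]
    exact htail_le z hz.1
end
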